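/- arXiv:2602.22773 — 2 statements merged into one kernel-verified Lean document; each statement's English description precedes it below -/
import Mathlib

section
/- Let a, b : ℤ → ℂ, let r := limsup_{n→+∞} (|a_{-n}| + |b_{-n}|)^{1/n} and let R := 1 / limsup_{n→+∞} (|a_n| + |b_n|)^{1/n} (with R = ∞ if this limsup is 0), and assume r < R. Let 1 ≤ p < ∞ and let K be a compact subset of the annulus Ω_{r,R} = {z ∈ ℂ : r < |z| < R}. Then there exists a constant M ≥ 0 such that for every λ = (λ_n)_{n∈ℤ} ∈ ℓ^p(ℤ;ℂ) and every z ∈ K, the series Σ_{n∈ℤ} |λ_n (a_n + b_n z) z^n| converges and Σ_{n∈ℤ} |λ_n (a_n + b_n z) z^n| ≤ M ‖λ‖_p. In particular, for each λ ∈ ℓ^p(ℤ;ℂ) the series Σ_{n∈ℤ} λ_n (a_n + b_n z) z^n converges absolutely at every point of Ω_{r,R}, uniformly on compact subsets. -/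
open Filter Finset
open scoped ENNReal NNReal

/-- `r := limsup_{n→+∞} (|a_{-n}| + |b_{-n}|)^{1/n}`, as an extended nonnegative real. -/
noncomputable def radiusInner (a b : ℤ → ℂ) : ℝ≥0∞ :=
  Filter.limsup (fun n : ℕ => ENNReal.ofReal ((‖a (-(n : ℤ))‖ + ‖b (-(n : ℤ))‖) ^ ((n : ℝ)⁻¹)))
    Filter.atTop

/-- `R := 1 / limsup_{n→+∞} (|a_n| + |b_n|)^{1/n}` (with `R = ∞` if the limsup is `0`). -/
noncomputable def radiusOuter (a b : ℤ → ℂ) : ℝ≥0∞ :=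
  (Filter.limsup (fun n : ℕ => ENNReal.ofReal ((‖a (n : ℤ)‖ + ‖b (n : ℤ)‖) ^ ((n : ℝ)⁻¹)))
    Filter.atTop)⁻¹

/-- The annulus `Ω_{r,R} = {z : r < |z| < R}`. -/
def annulus (a b : ℤ → ℂ) : Set ℂ :=
  {z : ℂ | radiusInner a b < ENNReal.ofReal ‖z‖ ∧ ENNReal.ofReal ‖z‖ < radiusOuter a b}

/-- Root test: if `limsup (c n)^{1/n} < y`, then `∑ c n / y^n` converges. -/
theorem summable_mul_inv_pow_of_limsup_lt {c : ℕ → ℝ} (hc : ∀ n, 0 ≤ c n) {y : ℝ} (hy : 0 < y)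
    (h : Filter.limsup (fun n : ℕ => ENNReal.ofReal (c n ^ ((n : ℝ)⁻¹))) Filter.atTop
      < ENNReal.ofReal y) :
    Summable (fun n : ℕ => c n * y⁻¹ ^ n) := by
  obtain ⟨q, hLq, hqy⟩ := ENNReal.lt_iff_exists_nnreal_btwn.1 h
  have hqy' : (q : ℝ) < y := by
    rwa [← ENNReal.ofReal_coe_nnreal, ENNReal.ofReal_lt_ofReal_iff hy] at hqy
  have hgeom : Summable (fun n : ℕ => ((q : ℝ) * y⁻¹) ^ n) := by
    refine summable_geometric_of_lt_one (by positivity) ?_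
    rw [← div_eq_mul_inv]
    exact (div_lt_one hy).2 hqy'
  refine hgeom.of_norm_bounded_eventually_nat ?_
  filter_upwards [Filter.eventually_lt_of_limsup_lt hLq, Filter.eventually_ne_atTop 0]
    with n hn hn0
  have hroot : c n ^ ((n : ℝ)⁻¹) < q := by
    rw [← ENNReal.ofReal_coe_nnreal] at hn
    exact (ENNReal.ofReal_lt_ofReal_iff_of_nonneg (Real.rpow_nonneg (hc n) _)).1 hn
  have hcn : c n ≤ (q : ℝ) ^ n := by
    rw [← Real.rpow_inv_natCast_pow (hc n) hn0]
    exact pow_le_pow_left₀ (Real.rpow_nonneg (hc n) _) hroot.le n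
  rw [Real.norm_of_nonneg (mul_nonneg (hc n) (by positivity)), mul_pow]
  gcongr

theorem norm_add_mul_le_add_mul_one_add {α β z : ℂ} {t : ℝ} (hz : ‖z‖ ≤ t) :
    ‖α + β * z‖ ≤ (‖α‖ + ‖β‖) * (1 + t) := by
  have h1 : ‖α + β * z‖ ≤ ‖α‖ + ‖β‖ * ‖z‖ := (norm_add_le _ _).trans_eq (by rw [norm_mul])
  have ht : 0 ≤ t := (norm_nonneg z).trans hz
  nlinarith [norm_nonneg α, norm_nonneg β, mul_le_mul_of_nonneg_left hz (norm_nonneg β),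
    mul_nonneg (norm_nonneg α) ht]

/-- On a compact subset of the annulus the functions `(a n + b n z) z^n` have a common summable
majorant. -/
theorem exists_summable_majorant (a b : ℤ → ℂ) {K : Set ℂ} (hK : IsCompact K)
    (hKΩ : K ⊆ annulus a b) :
    ∃ G : ℤ → ℝ, Summable G ∧ ∀ z ∈ K, ∀ n : ℤ, ‖(a n + b n * z) * z ^ n‖ ≤ G n := by
  rcases K.eq_empty_or_nonempty with rfl | hne
  · exact ⟨0, summable_zero, by simp⟩
  obtain ⟨w, hw, hmin⟩ := hK.exists_isMinOn hne continuous_norm.continuousOn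
  obtain ⟨v, hv, hmax⟩ := hK.exists_isMaxOn hne continuous_norm.continuousOn
  have hw0 : 0 < ‖w‖ := ENNReal.ofReal_pos.1 (pos_of_gt (hKΩ hw).1)
  have hle : ∀ z ∈ K, ‖w‖ ≤ ‖z‖ ∧ ‖z‖ ≤ ‖v‖ := fun z hz => ⟨hmin hz, hmax hz⟩
  have hv0 : 0 < ‖v‖ := hw0.trans_le (hle v hv).1
  refine ⟨fun n => (‖a n‖ + ‖b n‖) * (1 + ‖v‖) * max (‖w‖ ^ n) (‖v‖ ^ n), ?_, ?_⟩
  · refine Summable.of_nat_of_neg ?_ ?_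
    · have hS := summable_mul_inv_pow_of_limsup_lt (c := fun n : ℕ => ‖a (n : ℤ)‖ + ‖b (n : ℤ)‖)
        (fun n => by positivity) (inv_pos.2 hv0)
        (by rw [ENNReal.ofReal_inv_of_pos hv0]; exact ENNReal.lt_inv_iff_lt_inv.1 (hKΩ hv).2)
      refine (hS.mul_left (1 + ‖v‖)).congr fun n => ?_
      rw [zpow_natCast, zpow_natCast,
        max_eq_right (pow_le_pow_left₀ hw0.le (hle v hv).1 n), inv_inv]
      ring
    · have hS := summable_mul_inv_pow_of_limsup_lt
        (c := fun n : ℕ => ‖a (-(n : ℤ))‖ + ‖b (-(n : ℤ))‖)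
        (fun n => by positivity) hw0 (hKΩ hw).1
      refine (hS.mul_left (1 + ‖v‖)).congr fun n => ?_
      rw [zpow_neg, zpow_neg, zpow_natCast, zpow_natCast, max_eq_left
        (inv_anti₀ (pow_pos hw0 n) (pow_le_pow_left₀ hw0.le (hle v hv).1 n)), inv_pow]
      ring
  · intro z hz n
    obtain ⟨hwz, hzv⟩ := hle z hz
    have hz0 : 0 < ‖z‖ := hw0.trans_le hwz
    rw [norm_mul, norm_zpow]
    refine mul_le_mul (norm_add_mul_le_add_mul_one_add hzv) ?_ (by positivity) (by positivity)
    rcases le_total 0 n with hn | hn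
    · exact le_max_of_le_right (zpow_le_zpow_left₀ hn hz0.le hzv)
    · refine le_max_of_le_left ?_
      obtain ⟨m, rfl⟩ := Int.exists_eq_neg_ofNat hn
      rw [zpow_neg, zpow_neg, zpow_natCast, zpow_natCast]
      exact inv_anti₀ (pow_pos hw0 m) (pow_le_pow_left₀ hw0.le hwz m)

/-- On every compact subset `K` of the annulus there is a constant `M ≥ 0` such that for all
`λ ∈ ℓ^p(ℤ;ℂ)` and `z ∈ K` the series `Σ_{n∈ℤ} |λ_n (a_n + b_n z) z^n|` converges and is bounded
by `M ‖λ‖_p`; in particular the series converges absolutely at every point of the annulus. -/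
theorem stmt_0 (a b : ℤ → ℂ) (p : ℝ≥0∞) [Fact (1 ≤ p)] (hp : p ≠ ⊤)
    (hrR : radiusInner a b < radiusOuter a b)
    (K : Set ℂ) (hK : IsCompact K) (hKΩ : K ⊆ annulus a b) :
    (∃ M : ℝ, 0 ≤ M ∧ ∀ (f : lp (fun _ : ℤ => ℂ) p), ∀ z ∈ K,
        Summable (fun n : ℤ => ‖f n * (a n + b n * z) * z ^ n‖) ∧
        (∑' n : ℤ, ‖f n * (a n + b n * z) * z ^ n‖) ≤ M * ‖f‖) ∧
    (∀ (f : lp (fun _ : ℤ => ℂ) p), ∀ z ∈ annulus a b,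
        Summable (fun n : ℤ => ‖f n * (a n + b n * z) * z ^ n‖)) := by
  have hp0 : p ≠ 0 := (zero_lt_one.trans_le (Fact.out : 1 ≤ p)).ne'
  have key : ∀ L : Set ℂ, IsCompact L → L ⊆ annulus a b →
      ∃ M : ℝ, 0 ≤ M ∧ ∀ (f : lp (fun _ : ℤ => ℂ) p), ∀ z ∈ L,
        Summable (fun n : ℤ => ‖f n * (a n + b n * z) * z ^ n‖) ∧
        (∑' n : ℤ, ‖f n * (a n + b n * z) * z ^ n‖) ≤ M * ‖f‖ := by
    intro L hL hLΩ
    obtain ⟨G, hG, hbound⟩ := exists_summable_majorant a b hL hLΩ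
    refine ⟨max (∑' n, G n) 0, le_max_right _ _, fun f z hz => ?_⟩
    have hterm : ∀ n : ℤ, ‖f n * (a n + b n * z) * z ^ n‖ ≤ G n * ‖f‖ := fun n => by
      rw [mul_assoc, norm_mul, mul_comm]
      exact mul_le_mul (hbound z hz n) (lp.norm_apply_le_norm hp0 f n) (norm_nonneg _)
        ((norm_nonneg _).trans (hbound z hz n))
    have hsum : Summable (fun n : ℤ => ‖f n * (a n + b n * z) * z ^ n‖) :=
      (hG.mul_right ‖f‖).of_nonneg_of_le (fun _ => norm_nonneg _) hterm
    refine ⟨hsum, (hsum.tsum_le_tsum hterm (hG.mul_right _)).trans ?_⟩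
    rw [tsum_mul_right]
    exact mul_le_mul_of_nonneg_right (le_max_left _ _) (norm_nonneg f)
  refine ⟨key K hK hKΩ, fun f z hz => ?_⟩
  obtain ⟨M, -, hM⟩ := key {z} isCompact_singleton (Set.singleton_subset_iff.2 hz)
  exact (hM f z rfl).1
end

section
/- Let a, b : ℤ → ℂ, let r := limsup_{n→+∞} (|a_{-n}| + |b_{-n}|)^{1/n} and R := 1 / limsup_{n→+∞} (|a_n| + |b_n|)^{1/n}, and assume r < R. Let 1 ≤ p < ∞, λ ∈ ℓ^p(ℤ;ℂ), and define F : Ω_{r,R} → ℂ by F(z) := Σ_{m∈ℤ} λ_m (a_m + b_m z) z^m. Then for every ρ with r < ρ < R and every n ∈ ℤ, the circle integral (1/(2πi)) ∮_{|z|=ρ} F(z) / z^{n+1} dz equals λ_n a_n + λ_{n−1} b_{n−1}. In other words, the n-th Laurent coefficient of F on the annulus is λ_n a_n + λ_{n−1} b_{n−1}. -/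
open Filter Finset
open scoped ENNReal NNReal

/-- One half of the Cauchy–Hadamard criterion: if `limsup (g n)^{1/n} < s` then
`∑ g n * s⁻ⁿ` converges. -/
lemma summable_mul_inv_pow_of_limsup_lt_s2 {g : ℕ → ℝ} (hg : ∀ n, 0 ≤ g n) {s : ℝ} (hs : 0 < s)
    (h : limsup (fun n : ℕ => ENNReal.ofReal (g n ^ ((n : ℝ)⁻¹))) atTop < ENNReal.ofReal s) :
    Summable fun n => g n * s⁻¹ ^ n := by
  obtain ⟨t, ht₀, ht⟩ := ENNReal.lt_iff_exists_nnreal_btwn.1 h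
  have hts : (t : ℝ) < s := by
    rw [← ENNReal.ofReal_coe_nnreal] at ht
    exact (ENNReal.ofReal_lt_ofReal_iff hs).1 ht
  have hsum : Summable fun n : ℕ => ((t : ℝ) * s⁻¹) ^ n := by
    refine summable_geometric_of_lt_one (by positivity) ?_
    rwa [← div_eq_mul_inv, div_lt_one hs]
  refine hsum.of_norm_bounded_eventually_nat ?_
  filter_upwards [eventually_lt_of_limsup_lt ht₀, eventually_ne_atTop 0] with n hn hn0
  rw [← ENNReal.ofReal_coe_nnreal] at hn
  have hroot : g n ^ ((n : ℝ)⁻¹) ≤ t :=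
    (ENNReal.ofReal_le_ofReal_iff t.coe_nonneg).1 hn.le
  have hle : g n ≤ (t : ℝ) ^ n := by
    rw [← Real.rpow_inv_natCast_pow (hg n) hn0]
    exact pow_le_pow_left₀ (Real.rpow_nonneg (hg n) _) hroot n
  rw [Real.norm_of_nonneg (mul_nonneg (hg n) (by positivity)), mul_pow]
  gcongr

/-- The coefficients `|a_m| + |b_m|` are summable against `ρ ^ m` for every radius `ρ` strictly
inside the annulus of convergence. -/
lemma summable_norm_add_norm_mul_zpow {a b : ℤ → ℂ} {ρ : ℝ} (hρ : 0 < ρ)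
    (hρ₁ : radiusInner a b < ENNReal.ofReal ρ) (hρ₂ : ENNReal.ofReal ρ < radiusOuter a b) :
    Summable fun m : ℤ => (‖a m‖ + ‖b m‖) * ρ ^ m := by
  refine Summable.of_nat_of_neg ?_ ?_
  · have h := summable_mul_inv_pow_of_limsup_lt_s2 (g := fun n : ℕ => ‖a n‖ + ‖b n‖)
      (fun n => by positivity) (inv_pos.2 hρ) (by
        rw [ENNReal.ofReal_inv_of_pos hρ]
        exact ENNReal.lt_inv_iff_lt_inv.1 hρ₂)
    simpa using h
  · have h := summable_mul_inv_pow_of_limsup_lt_s2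
      (g := fun n : ℕ => ‖a (-(n : ℤ))‖ + ‖b (-(n : ℤ))‖) (fun n => by positivity) hρ hρ₁
    simpa using h

/-- Circle integrals commute with uniformly summable series of continuous functions. -/
lemma hasSum_circleIntegral_of_norm_le {ι : Type*} [Countable ι] {g : ι → ℂ → ℂ} {u : ι → ℝ}
    {c : ℂ} {ρ : ℝ} (hρ : 0 ≤ ρ) (hg : ∀ i, ContinuousOn (g i) (Metric.sphere c ρ))
    (hu : Summable u) (hgu : ∀ i, ∀ z ∈ Metric.sphere c ρ, ‖g i z‖ ≤ u i) :
    HasSum (fun i => ∮ z in C(c, ρ), g i z) (∮ z in C(c, ρ), ∑' i, g i z) := by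
  have hmem := circleMap_mem_sphere c hρ
  refine intervalIntegral.hasSum_integral_of_dominated_convergence
    (fun i _ => ρ * u i) (fun i => ?_) (fun i => ?_) ?_ intervalIntegrable_const ?_
  · have hcont : Continuous fun θ => deriv (circleMap c ρ) θ • g i (circleMap c ρ θ) := by
      simp only [deriv_circleMap]
      exact ((continuous_circleMap 0 ρ).mul continuous_const).smul
        ((hg i).comp_continuous (continuous_circleMap c ρ) hmem)
    exact hcont.aestronglyMeasurable
  · refine .of_forall fun θ _ => ?_
    have hd : ‖deriv (circleMap c ρ) θ‖ = ρ := by simp [abs_of_nonneg hρ]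
    rw [norm_smul, hd]
    exact mul_le_mul_of_nonneg_left (hgu i _ (hmem θ)) hρ
  · exact .of_forall fun _ _ => hu.mul_left ρ
  · exact .of_forall fun θ _ =>
      (hu.of_norm_bounded fun i => hgu i _ (hmem θ)).hasSum.const_smul _

lemma circleIntegral_zpow {ρ : ℝ} (hρ : ρ ≠ 0) (k : ℤ) :
    (∮ z in C(0, ρ), z ^ k) = if k = -1 then 2 * Real.pi * Complex.I else 0 := by
  split_ifs with hk
  · simpa [hk] using circleIntegral.integral_sub_center_inv 0 hρ
  · simpa using circleIntegral.integral_sub_zpow_of_ne hk 0 0 ρ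

/-- The Laurent coefficients of a single term `l * (α + β z) z ^ m`. -/
lemma circleIntegral_affine_mul_zpow_div {ρ : ℝ} (hρ : 0 < ρ) (l α β : ℂ) (m n : ℤ) :
    (∮ z in C(0, ρ), l * (α + β * z) * z ^ m / z ^ (n + 1)) =
      (if m = n then 2 * Real.pi * Complex.I * (l * α) else 0) +
        if m = n - 1 then 2 * Real.pi * Complex.I * (l * β) else 0 := by
  have hne : ∀ z ∈ Metric.sphere (0 : ℂ) ρ, z ≠ 0 := fun z hz =>
    ne_zero_of_mem_sphere hρ.ne' ⟨z, hz⟩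
  have hint (x : ℂ) (k : ℤ) : CircleIntegrable (fun z => x * z ^ k) 0 ρ :=
    ContinuousOn.circleIntegrable hρ.le
      (continuousOn_const.mul fun z hz =>
        (continuousAt_zpow₀ z k (.inl (hne z hz))).continuousWithinAt)
  have hcongr : (∮ z in C(0, ρ), l * (α + β * z) * z ^ m / z ^ (n + 1)) =
      ∮ z in C(0, ρ), (l * α * z ^ (m - n - 1) + l * β * z ^ (m - n)) := by
    refine circleIntegral.integral_congr hρ.le fun z hz => ?_
    have hz0 := hne z hz
    simp only [zpow_sub₀ hz0, zpow_add₀ hz0, zpow_one]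
    field_simp
  rw [hcongr, circleIntegral.integral_add (hint _ _) (hint _ _),
    circleIntegral.integral_const_mul, circleIntegral.integral_const_mul,
    circleIntegral_zpow hρ.ne', circleIntegral_zpow hρ.ne',
    if_congr (show m - n - 1 = -1 ↔ m = n by lia) rfl rfl,
    if_congr (show m - n = -1 ↔ m = n - 1 by lia) rfl rfl]
  split_ifs <;> ring

/-- For `F(z) := Σ_{m∈ℤ} λ_m (a_m + b_m z) z^m` with `λ ∈ ℓ^p(ℤ;ℂ)`, and any radius
`r < ρ < R` and `n ∈ ℤ`, the circle integral `(1/(2πi)) ∮_{|z|=ρ} F(z)/z^{n+1} dz` equals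
`λ_n a_n + λ_{n-1} b_{n-1}`. -/
theorem stmt_2 (a b : ℤ → ℂ) (p : ℝ≥0∞) [Fact (1 ≤ p)] (hp : p ≠ ⊤)
    (hrR : radiusInner a b < radiusOuter a b)
    (f : lp (fun _ : ℤ => ℂ) p)
    (F : ℂ → ℂ) (hF : ∀ z : ℂ, F z = ∑' m : ℤ, f m * (a m + b m * z) * z ^ m)
    (ρ : ℝ) (hρ₁ : radiusInner a b < ENNReal.ofReal ρ)
    (hρ₂ : ENNReal.ofReal ρ < radiusOuter a b) (n : ℤ) :
    (2 * Real.pi * Complex.I)⁻¹ * (∮ z in C(0, ρ), F z / z ^ (n + 1)) =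
      f n * a n + f (n - 1) * b (n - 1) := by
  have hρ : 0 < ρ := ENNReal.ofReal_pos.1 (bot_le.trans_lt hρ₁)
  have hp0 : p ≠ 0 := (zero_lt_one.trans_le (Fact.out : 1 ≤ p)).ne'
  have hsum := (summable_norm_add_norm_mul_zpow hρ hρ₁ hρ₂).mul_left
    (‖f‖ * (1 + ρ) / ρ ^ (n + 1))
  have hne : ∀ z ∈ Metric.sphere (0 : ℂ) ρ, z ≠ 0 := fun z hz =>
    ne_zero_of_mem_sphere hρ.ne' ⟨z, hz⟩
  have key := hasSum_circleIntegral_of_norm_le (c := 0)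
    (g := fun m z => f m * (a m + b m * z) * z ^ m / z ^ (n + 1)) hρ.le
    (fun m z hz => by
      have hz0 := hne z hz
      have h₁ := continuousAt_zpow₀ z m (.inl hz0)
      have h₂ := continuousAt_zpow₀ z (n + 1) (.inl hz0)
      have h₃ : ContinuousAt (fun z : ℂ => f m * (a m + b m * z)) z := by fun_prop
      exact ((h₃.mul h₁).div h₂ (zpow_ne_zero _ hz0)).continuousWithinAt)
    hsum
    (fun m z hz => by
      have hz' : ‖z‖ = ρ := by simpa using hz
      have hlin : ‖a m + b m * z‖ ≤ (1 + ρ) * (‖a m‖ + ‖b m‖) := by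
        refine (norm_add_le _ _).trans ?_
        rw [norm_mul, hz']
        nlinarith [norm_nonneg (a m), norm_nonneg (b m)]
      rw [norm_div, norm_mul, norm_mul, norm_zpow, norm_zpow, hz']
      calc ‖f m‖ * ‖a m + b m * z‖ * ρ ^ m / ρ ^ (n + 1)
          ≤ ‖f‖ * ((1 + ρ) * (‖a m‖ + ‖b m‖)) * ρ ^ m / ρ ^ (n + 1) := by
            gcongr
            exact lp.norm_apply_le_norm hp0 f m
        _ = _ := by ring)
  simp only [circleIntegral_affine_mul_zpow_div hρ, tsum_div_const, ← hF] at key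
  have hval := ((hasSum_ite_eq n (2 * Real.pi * Complex.I * (f n * a n))).add
    (hasSum_ite_eq (n - 1) (2 * Real.pi * Complex.I * (f (n - 1) * b (n - 1)))))
  have heq := key.unique (hval.congr_fun fun m => by
    congr 1 <;> split_ifs with h <;> simp [h])
  rw [heq, ← mul_add, inv_mul_cancel_left₀ Complex.two_pi_I_ne_zero]
end
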